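/- arXiv:2001.09576 — 3 statements merged into one kernel-verified Lean document; each statement's English description precedes it below -/
import Mathlib

section
/- Let u ∈ (0,∞], and let x, w : [0,u) → ℝ be continuously differentiable curves. Suppose there are functions f : ℝ × [0,u) → ℝ and g : ℝ → ℝ such that x′(t) = f(x(t),t) and w′(t) = g(w(t)) for all t ∈ [0,u). Assume: (1) w(0) > x(0); (2) g(z) ≥ 0 for all z ∈ ℝ; (3) for every t ∈ [0,u) with x(t) ≥ w(0), one has g(x(t)) > f(x(t),t). Then x(t) < w(t) for all t ∈ [0,u). -/
open Set

/-- A function on `[a, b]` attaining its maximum at the right endpoint has nonnegative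
derivative there. -/
lemma HasDerivWithinAt.nonneg_of_isMaxOn_right {d : ℝ → ℝ} {d' a b : ℝ} (hab : a < b)
    (hd : HasDerivWithinAt d d' (Icc a b) b) (hmax : ∀ s ∈ Icc a b, d s ≤ d b) : 0 ≤ d' := by
  have hd := (hd.mono Ico_subset_Icc_self)
  rw [hasDerivWithinAt_iff_tendsto_slope' (by simp), nhdsWithin_Ico_eq_nhdsLT hab] at hd
  refine ge_of_tendsto hd ?_
  filter_upwards [Ico_mem_nhdsLT hab] with s hs
  rw [slope_def_field]
  exact div_nonneg_of_nonpos (sub_nonpos.2 (hmax s (Ico_subset_Icc_self hs)))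
    (sub_nonpos.2 hs.2.le)

/-- Lemma: scalar comparison inequality for curves.
Here `u ∈ (0,∞]` is encoded as an extended real, and the interval `[0,u)` is
`{t : ℝ | 0 ≤ t ∧ (t : EReal) < u}`. The curves `x` and `w` are continuously
differentiable on that interval with derivatives `f(x(t),t)` and `g(w(t))`. -/
theorem statement12 (u : EReal) (hu : 0 < u)
    (x w : ℝ → ℝ) (f : ℝ → ℝ → ℝ) (g : ℝ → ℝ)
    (S : Set ℝ) (hSdef : S = {t : ℝ | 0 ≤ t ∧ (t : EReal) < u})
    (hx : ∀ t ∈ S, HasDerivWithinAt x (f (x t) t) S t)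
    (hxc : ContinuousOn (fun t => f (x t) t) S)
    (hw : ∀ t ∈ S, HasDerivWithinAt w (g (w t)) S t)
    (hwc : ContinuousOn (fun t => g (w t)) S)
    (h1 : x 0 < w 0)
    (h2 : ∀ z, 0 ≤ g z)
    (h3 : ∀ t ∈ S, w 0 ≤ x t → f (x t) t < g (x t)) :
    ∀ t ∈ S, x t < w t := by
  intro t ht
  have hsub : Icc 0 t ⊆ S := by
    rw [hSdef] at ht ⊢
    exact fun s hs => ⟨hs.1, (EReal.coe_le_coe_iff.2 hs.2).trans_lt ht.2⟩
  have h0 : 0 ≤ t := by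
    rw [hSdef] at ht
    exact ht.1
  have hx' : ∀ s ∈ Icc 0 t, HasDerivWithinAt x (f (x s) s) (Icc 0 t) s :=
    fun s hs => (hx s (hsub hs)).mono hsub
  have hw' : ∀ s ∈ Icc 0 t, HasDerivWithinAt w (g (w s)) (Icc 0 t) s :=
    fun s hs => (hw s (hsub hs)).mono hsub
  have hxcont : ContinuousOn x (Icc 0 t) := fun s hs => (hx' s hs).continuousWithinAt
  have hwcont : ContinuousOn w (Icc 0 t) := fun s hs => (hw' s hs).continuousWithinAt
  have hmono : MonotoneOn w (Icc 0 t) :=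
    monotoneOn_of_hasDerivWithinAt_nonneg (convex_Icc 0 t) hwcont
      (fun s hs => (hw' s (interior_subset hs)).mono interior_subset) (fun s _ => h2 (w s))
  have hlt : ∀ s ∈ Icc 0 t, x s = w s → f (x s) s < g (w s) := by
    intro s hs heq
    have := h3 s (hsub hs) (heq ▸ hmono (left_mem_Icc.2 h0) hs hs.1)
    rwa [← heq]
  have hle : ∀ ⦃s⦄, s ∈ Icc 0 t → x s ≤ w s :=
    image_le_of_deriv_right_lt_deriv_boundary' hxcont
      (fun s hs => (hx' s (Ico_subset_Icc_self hs)).mono_of_mem_nhdsWithin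
        (Icc_mem_nhdsGE_of_mem hs)) h1.le hwcont
      (fun s hs => (hw' s (Ico_subset_Icc_self hs)).mono_of_mem_nhdsWithin
        (Icc_mem_nhdsGE_of_mem hs))
      (fun s hs => hlt s (Ico_subset_Icc_self hs))
  have htt : t ∈ Icc 0 t := right_mem_Icc.2 h0
  refine (hle htt).lt_of_ne fun heq => ?_
  have hpos : 0 < t := h0.lt_of_ne fun h => by
    subst h
    exact h1.ne heq
  have hnonneg := ((hx' t htt).sub (hw' t htt)).nonneg_of_isMaxOn_right hpos fun s hs => by
    simpa [heq] using hle hs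
  linarith [hlt t htt heq]
end

section
/- Let ‖·‖ be any norm on ℝ^d, let u > 0, and let v : [0,u) → ℝ^d be a continuously differentiable curve. Let g : ℝ → ℝ be non-negative and non-decreasing with ‖v′(t)‖ ≤ g(‖v(t)‖) for all t ∈ [0,u). Fix η > 0 and let h : ℝ → ℝ satisfy h(z) ≥ max{0, g(z) + η} for all z ≥ ‖v(0)‖. If the scalar ODE w(0) = ‖v(0)‖ + η, w′(t) = h(w(t)) has a continuously differentiable solution w defined on [0,u), then ‖v(t)‖ ≤ w(t) for all t ∈ [0,u). -/
open Set

/-- Lemma: norm comparison for vector ODEs. `ℝ^d` equipped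
with an arbitrary norm is formalized as a finite-dimensional real normed space `E`. -/
theorem statement13 {E : Type*} [NormedAddCommGroup E] [NormedSpace ℝ E]
    [FiniteDimensional ℝ E]
    (u : ℝ) (hu : 0 < u)
    (v : ℝ → E) (v' : ℝ → E)
    (hv : ∀ t ∈ Ico 0 u, HasDerivWithinAt v (v' t) (Ico 0 u) t)
    (hvc : ContinuousOn v' (Ico 0 u))
    (g : ℝ → ℝ) (hg0 : ∀ z, 0 ≤ g z) (hgmono : Monotone g)
    (hgb : ∀ t ∈ Ico 0 u, ‖v' t‖ ≤ g ‖v t‖)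
    (η : ℝ) (hη : 0 < η)
    (h : ℝ → ℝ) (hh : ∀ z, ‖v 0‖ ≤ z → max 0 (g z + η) ≤ h z)
    (w : ℝ → ℝ) (hw0 : w 0 = ‖v 0‖ + η)
    (hw : ∀ t ∈ Ico 0 u, HasDerivWithinAt w (h (w t)) (Ico 0 u) t)
    (hwc : ContinuousOn (fun t => h (w t)) (Ico 0 u)) :
    ∀ t ∈ Ico 0 u, ‖v t‖ ≤ w t := by
  intro t ht
  have hsub : Icc 0 t ⊆ Ico 0 u := fun x hx => ⟨hx.1, hx.2.trans_lt ht.2⟩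
  have hnhds : ∀ x ∈ Ico 0 t, Ico 0 u ∈ nhdsWithin x (Ici x) := fun x hx =>
    Filter.mem_of_superset (Ico_mem_nhdsGE (hx.2.trans ht.2)) (Ico_subset_Ico_left hx.1)
  have hwcont : ContinuousOn w (Icc 0 t) := fun x hx =>
    (hw x (hsub hx)).continuousWithinAt.mono hsub
  have hwderiv : ∀ x ∈ Ico 0 t, HasDerivWithinAt w (h (w x)) (Ici x) x := fun x hx =>
    (hw x (hsub (Ico_subset_Icc_self hx))).mono_of_mem_nhdsWithin (hnhds x hx)
  have hgh : ∀ z, ‖v 0‖ ≤ z → g z < h z := fun z hz => by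
    linarith [(le_max_right 0 (g z + η)).trans (hh z hz)]
  have hw_ge : ∀ x ∈ Icc 0 t, ‖v 0‖ ≤ w x := fun x hx =>
    image_norm_le_of_norm_deriv_right_lt_deriv_boundary' (f := fun _ => v 0) (f' := fun _ => 0)
      continuousOn_const (fun x _ => hasDerivWithinAt_const x _ _) (by linarith) hwcont hwderiv
      (fun x _ hx => by simpa using (hg0 _).trans_lt (hgh (w x) hx.le)) hx
  refine image_norm_le_of_norm_deriv_right_lt_deriv_boundary' (f := v) (f' := v')
    (fun x hx => (hv x (hsub hx)).continuousWithinAt.mono hsub)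
    (fun x hx => (hv x (hsub (Ico_subset_Icc_self hx))).mono_of_mem_nhdsWithin (hnhds x hx))
    (by linarith) hwcont hwderiv (fun x hx hvw => ?_) (right_mem_Icc.2 ht.1)
  have hx' := Ico_subset_Icc_self hx
  exact (hgb x (hsub hx')).trans_lt (hvw ▸ hgh (w x) (hw_ge x hx'))
end

section
/- Let X be a symmetric positive definite matrix written in block form X = [X₁₁, X₁₂; X₁₂ᵀ, X₂₂], where X₁₁ and X₂₂ are square symmetric blocks. Then for all α₁, α₂ > 0, X² ⪰ [(1−α₁)X₁₁² + (1−α₂⁻¹)X₁₂X₁₂ᵀ, 0; 0, (1−α₂)X₂₂² + (1−α₁⁻¹)X₁₂ᵀX₁₂] in the positive-semidefinite (Loewner) order. -/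
open scoped Matrix

/-- The Loewner (positive semidefinite) partial order `M ⪯ N`. -/
def loewnerLE {ι : Type*} [Fintype ι] (M N : Matrix ι ι ℝ) : Prop :=
  (N - M).PosSemidef

/-- Lemma: Loewner lower bound for the square of a block
positive definite matrix. -/
theorem statement19 {p q : ℕ}
    (X11 : Matrix (Fin p) (Fin p) ℝ) (X22 : Matrix (Fin q) (Fin q) ℝ)
    (X12 : Matrix (Fin p) (Fin q) ℝ)
    (hpd : (Matrix.fromBlocks X11 X12 X12ᵀ X22).PosDef)
    (α₁ α₂ : ℝ) (hα₁ : 0 < α₁) (hα₂ : 0 < α₂) :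
    loewnerLE
      (Matrix.fromBlocks
        ((1 - α₁) • (X11 * X11) + (1 - α₂⁻¹) • (X12 * X12ᵀ)) 0 0
        ((1 - α₂) • (X22 * X22) + (1 - α₁⁻¹) • (X12ᵀ * X12)))
      (Matrix.fromBlocks X11 X12 X12ᵀ X22 ^ 2) := by
  have hherm := Matrix.isHermitian_fromBlocks_iff.mp hpd.isHermitian
  have h11 : X11ᵀ = X11 := by simpa [Matrix.IsHermitian] using hherm.1
  have h22 : X22ᵀ = X22 := by simpa [Matrix.IsHermitian] using hherm.2.2.2
  unfold loewnerLE
  have key :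
      Matrix.fromBlocks X11 X12 X12ᵀ X22 ^ 2 -
        Matrix.fromBlocks
          ((1 - α₁) • (X11 * X11) + (1 - α₂⁻¹) • (X12 * X12ᵀ)) 0 0
          ((1 - α₂) • (X22 * X22) + (1 - α₁⁻¹) • (X12ᵀ * X12)) =
      α₁⁻¹ • (Matrix.fromRows (α₁ • X11) X12ᵀ * (Matrix.fromRows (α₁ • X11) X12ᵀ)ᴴ) +
      α₂⁻¹ • (Matrix.fromRows X12 (α₂ • X22) * (Matrix.fromRows X12 (α₂ • X22))ᴴ) := by
    rw [sub_eq_iff_eq_add]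
    simp only [Matrix.conjTranspose_eq_transpose_of_trivial, Matrix.transpose_fromRows,
      Matrix.fromRows_mul_fromCols, pow_two, Matrix.fromBlocks_multiply,
      Matrix.fromBlocks_smul, Matrix.fromBlocks_add, Matrix.transpose_smul, h11, h22,
      Matrix.transpose_transpose, Matrix.smul_mul, Matrix.mul_smul, smul_smul,
      inv_mul_cancel_left₀ hα₁.ne', inv_mul_cancel_left₀ hα₂.ne',
      inv_mul_cancel₀ hα₁.ne', inv_mul_cancel₀ hα₂.ne', one_smul]
    congr 1 <;> module
  rw [key]
  exact ((Matrix.posSemidef_self_mul_conjTranspose _).smul (inv_nonneg.mpr hα₁.le)).add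
    ((Matrix.posSemidef_self_mul_conjTranspose _).smul (inv_nonneg.mpr hα₂.le))
end
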